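/- arXiv:1606.03041 — 6 statements merged into one kernel-verified Lean document; each statement's English description precedes it below -/
import Mathlib

section
/- If σ'(z) < 0 for every z > 0, then ξ_r is strictly convex on the interval (0,∞). -/
open Real MeasureTheory

/-- The function `ξ_r(x) = x (σ(r)/r − ∫_r^x σ(z)/z² dz)`. -/
noncomputable def xi (σ : ℝ → ℝ) (r : ℝ) (x : ℝ) : ℝ :=
  x * (σ r / r - ∫ z in r..x, σ z / z ^ 2)

/-- If `σ' < 0` on `(0,∞)` then `ξ_r` is strictly convex on `(0,∞)`. -/
theorem xi_strictConvexOn (σ σ' : ℝ → ℝ) (r : ℝ) (hr : 0 < r)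
    (hσ : ∀ z ∈ Set.Ioi (0 : ℝ), HasDerivAt σ (σ' z) z)
    (hσ' : ContinuousOn σ' (Set.Ioi 0))
    (hneg : ∀ z > (0 : ℝ), σ' z < 0) :
    StrictConvexOn ℝ (Set.Ioi 0) (xi σ r) := by
  have hc : ContinuousOn (fun z => σ z / z ^ 2) (Set.Ioi 0) := by
    apply ContinuousOn.div
    · exact fun z hz => (hσ z hz).continuousAt.continuousWithinAt
    · fun_prop
    · intro z hz
      exact pow_ne_zero 2 (ne_of_gt hz)
  have hI : ∀ x ∈ Set.Ioi (0 : ℝ),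
      HasDerivAt (fun x => ∫ z in r..x, σ z / z ^ 2) (σ x / x ^ 2) x := by
    intro x hx
    apply intervalIntegral.integral_hasDerivAt_right
    · apply ContinuousOn.intervalIntegrable
      apply hc.mono
      intro y hy
      exact lt_of_lt_of_le (lt_min hr hx) hy.1
    · exact hc.stronglyMeasurableAtFilter isOpen_Ioi x hx
    · exact hc.continuousAt (Ioi_mem_nhds hx)
  have h1 : ∀ x ∈ Set.Ioi (0 : ℝ), HasDerivAt (xi σ r)
      ((σ r / r - ∫ z in r..x, σ z / z ^ 2) - σ x / x) x := by
    intro x hx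
    have hx0 : x ≠ 0 := ne_of_gt hx
    have h := (hasDerivAt_id x).mul ((hI x hx).const_sub (σ r / r))
    refine HasDerivAt.congr_deriv (f := xi σ r) h ?_
    simp only [id]
    field_simp
    ring
  have h2 : ∀ x ∈ Set.Ioi (0 : ℝ), HasDerivAt
      (fun x => (σ r / r - ∫ z in r..x, σ z / z ^ 2) - σ x / x) (-σ' x / x) x := by
    intro x hx
    have hx0 : x ≠ 0 := ne_of_gt hx
    have h := ((hI x hx).const_sub (σ r / r)).sub ((hσ x hx).div (hasDerivAt_id x) hx0)
    refine HasDerivAt.congr_deriv h ?_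
    simp only [id]
    field_simp
    ring
  apply strictConvexOn_of_deriv2_pos' (convex_Ioi 0)
  · exact fun x hx => (h1 x hx).continuousAt.continuousWithinAt
  · intro x hx
    have he : deriv (xi σ r) =ᶠ[nhds x]
        (fun x => (σ r / r - ∫ z in r..x, σ z / z ^ 2) - σ x / x) := by
      filter_upwards [Ioi_mem_nhds hx] with y hy
      exact (h1 y hy).deriv
    change 0 < deriv (deriv (xi σ r)) x
    rw [he.deriv_eq, (h2 x hx).deriv]
    exact div_pos (neg_pos.2 (hneg x hx)) hx
end

section
/- If σ'(z) < 0 for every z > 0, then ξ_r is strictly decreasing on (0, r]; that is, for all x, y with 0 < x < y ≤ r one has ξ_r(y) < ξ_r(x). -/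
open Real MeasureTheory

/-- If `σ' < 0` on `(0,∞)` then `ξ_r` is strictly decreasing on `(0, r]`. -/
theorem xi_strictAnti (σ σ' : ℝ → ℝ) (r : ℝ) (hr : 0 < r)
    (hσ : ∀ z ∈ Set.Ioi (0 : ℝ), HasDerivAt σ (σ' z) z)
    (hσ' : ContinuousOn σ' (Set.Ioi 0))
    (hneg : ∀ z > (0 : ℝ), σ' z < 0) :
    ∀ x y : ℝ, 0 < x → x < y → y ≤ r → xi σ r y < xi σ r x := by
  have hI : ∀ x > (0 : ℝ), HasDerivAt (fun x => ∫ z in r..x, σ z / z ^ 2) (σ x / x ^ 2) x := by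
    intro x hx
    have hc : ContinuousOn (fun z => σ z / z ^ 2) (Set.Ioi 0) := by
      intro z hz
      have hz' : z ^ 2 ≠ 0 := pow_ne_zero 2 (ne_of_gt hz)
      exact ((hσ z hz).continuousAt.div (continuousAt_id.pow 2) hz').continuousWithinAt
    have hsub : Set.uIcc r x ⊆ Set.Ioi 0 := fun z hz =>
      lt_of_lt_of_le (lt_min hr hx) hz.1
    exact intervalIntegral.integral_hasDerivAt_right
      ((hc.mono hsub).intervalIntegrable)
      (hc.stronglyMeasurableAtFilter isOpen_Ioi x hx)
      (hc.continuousAt (isOpen_Ioi.mem_nhds hx))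
  have hg : ∀ x > (0 : ℝ), HasDerivAt
      (fun x => σ r / r - (∫ z in r..x, σ z / z ^ 2) - σ x / x) (-σ' x / x) x := by
    intro x hx
    have hx' : x ≠ 0 := ne_of_gt hx
    have h := ((hI x hx).const_sub (σ r / r)).sub ((hσ x hx).div (hasDerivAt_id x) hx')
    refine h.congr_deriv ?_
    simp only [id]
    field_simp
    ring
  have hmono : StrictMonoOn
      (fun x => σ r / r - (∫ z in r..x, σ z / z ^ 2) - σ x / x) (Set.Ioi 0) := by
    refine strictMonoOn_of_deriv_pos (convex_Ioi 0)
      (fun x hx => (hg x hx).continuousAt.continuousWithinAt) ?_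
    intro x hx
    rw [interior_Ioi] at hx
    rw [(hg x hx).deriv]
    exact div_pos (neg_pos.2 (hneg x hx)) hx
  have hxi : ∀ x > (0 : ℝ), HasDerivAt (xi σ r)
      (σ r / r - (∫ z in r..x, σ z / z ^ 2) - σ x / x) x := by
    intro x hx
    have hx' : x ≠ 0 := ne_of_gt hx
    have h := (hasDerivAt_id x).mul ((hI x hx).const_sub (σ r / r))
    refine HasDerivAt.congr_deriv (f := xi σ r) h ?_
    simp only [id]
    field_simp
    ring
  have hanti : StrictAntiOn (xi σ r) (Set.Ioc 0 r) := by
    refine strictAntiOn_of_deriv_neg (convex_Ioc 0 r)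
      (fun x hx => (hxi x hx.1).continuousAt.continuousWithinAt) ?_
    intro x hx
    rw [interior_Ioc] at hx
    rw [(hxi x hx.1).deriv]
    have h := hmono (Set.mem_Ioi.2 hx.1) (Set.mem_Ioi.2 hr) hx.2
    simpa using h
  intro x y hx hxy hy
  exact hanti ⟨hx, hxy.le.trans hy⟩ ⟨hx.trans hxy, hy⟩ hxy
end

section
/- If σ'(z) < 0 for every z > 0, then ξ_r is strictly increasing on [r, ∞); that is, for all x, y with r ≤ x < y one has ξ_r(x) < ξ_r(y). -/
open Real MeasureTheory

/-- If `σ' < 0` on `(0,∞)` then `ξ_r` is strictly increasing on `[r, ∞)`. -/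
theorem xi_strictMono (σ σ' : ℝ → ℝ) (r : ℝ) (hr : 0 < r)
    (hσ : ∀ z ∈ Set.Ioi (0 : ℝ), HasDerivAt σ (σ' z) z)
    (hσ' : ContinuousOn σ' (Set.Ioi 0))
    (hneg : ∀ z > (0 : ℝ), σ' z < 0) :
    ∀ x y : ℝ, r ≤ x → x < y → xi σ r x < xi σ r y := by
  have hcont : ContinuousOn (fun z => σ z / z ^ 2) (Set.Ioi 0) := by
    intro z hz
    have hz' : z ^ 2 ≠ 0 := pow_ne_zero 2 (ne_of_gt hz)
    have h2 : ContinuousAt (fun z : ℝ => z ^ 2) z := by fun_prop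
    exact ((hσ z hz).continuousAt.div h2 hz').continuousWithinAt
  have hI : ∀ x, 0 < x → HasDerivAt (fun x => ∫ z in r..x, σ z / z ^ 2) (σ x / x ^ 2) x := by
    intro x hx
    apply intervalIntegral.integral_hasDerivAt_right
    · apply ContinuousOn.intervalIntegrable
      apply hcont.mono
      intro z hz
      exact lt_of_lt_of_le (lt_min hr hx) hz.1
    · exact hcont.stronglyMeasurableAtFilter isOpen_Ioi x hx
    · exact hcont.continuousAt (Ioi_mem_nhds hx)
  have hh : ∀ x, 0 < x → HasDerivAt
      (fun x => σ r / r - (∫ z in r..x, σ z / z ^ 2) - σ x / x) (-σ' x / x) x := by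
    intro x hx
    have h := ((hI x hx).const_sub (σ r / r)).sub ((hσ x hx).div (hasDerivAt_id x) hx.ne')
    refine HasDerivAt.congr_deriv h ?_
    simp only [id]
    field_simp
    ring
  have hmono : StrictMonoOn
      (fun x => σ r / r - (∫ z in r..x, σ z / z ^ 2) - σ x / x) (Set.Ici r) := by
    apply strictMonoOn_of_deriv_pos (convex_Ici r)
    · intro x hx
      exact (hh x (lt_of_lt_of_le hr hx)).continuousAt.continuousWithinAt
    · intro x hx
      rw [interior_Ici] at hx
      have hx0 : 0 < x := lt_trans hr hx
      rw [(hh x hx0).deriv]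
      exact div_pos (neg_pos.mpr (hneg x hx0)) hx0
  have hxi : ∀ x, 0 < x → HasDerivAt (xi σ r)
      (σ r / r - (∫ z in r..x, σ z / z ^ 2) - σ x / x) x := by
    intro x hx
    have h := (hasDerivAt_id x).mul ((hI x hx).const_sub (σ r / r))
    refine HasDerivAt.congr_deriv h ?_
    simp only [id]
    field_simp
    ring
  have key : StrictMonoOn (xi σ r) (Set.Ici r) := by
    apply strictMonoOn_of_deriv_pos (convex_Ici r)
    · intro x hx
      exact (hxi x (lt_of_lt_of_le hr hx)).continuousAt.continuousWithinAt
    · intro x hx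
      rw [interior_Ici] at hx
      have hx0 : 0 < x := lt_trans hr hx
      rw [(hxi x hx0).deriv]
      have h := hmono (Set.mem_Ici.mpr le_rfl) (Set.mem_Ici.mpr (le_of_lt hx)) hx
      simpa using h
  intro x y hx hxy
  exact key hx (hx.trans hxy.le) hxy
end

section
/- If σ'(z) ≤ 0 for every z > 0, then ξ_r(x) ≥ σ(r) for every x > 0 (so ξ_r attains its minimum value σ(r) at x = r, since ξ_r(r) = σ(r)). -/
open Real MeasureTheory

/-- If `σ' ≤ 0` on `(0,∞)` then `ξ_r(x) ≥ σ(r)` for every `x > 0`, and `ξ_r(r) = σ(r)`. -/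
theorem xi_ge_sigma_r (σ σ' : ℝ → ℝ) (r : ℝ) (hr : 0 < r)
    (hσ : ∀ z ∈ Set.Ioi (0 : ℝ), HasDerivAt σ (σ' z) z)
    (hσ' : ContinuousOn σ' (Set.Ioi 0))
    (hnonpos : ∀ z > (0 : ℝ), σ' z ≤ 0) :
    (∀ x > (0 : ℝ), σ r ≤ xi σ r x) ∧ xi σ r r = σ r := by

  refine ⟨fun x hx => ?_, ?_⟩
  · have hanti : AntitoneOn σ (Set.Ioi 0) := by
      apply antitoneOn_of_deriv_nonpos (convex_Ioi 0)
      · exact fun z hz => (hσ z hz).continuousAt.continuousWithinAt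
      · intro z hz
        rw [interior_Ioi] at hz
        exact (hσ z hz).differentiableAt.differentiableWithinAt
      · intro z hz
        rw [interior_Ioi] at hz
        rw [(hσ z hz).deriv]
        exact hnonpos z hz
    have hpos : ∀ z ∈ Set.uIcc r x, 0 < z := fun z hz =>
      lt_of_lt_of_le (lt_min hr hx) hz.1
    have hi1 : IntervalIntegrable (fun z => σ z / z ^ 2) volume r x := by
      apply ContinuousOn.intervalIntegrable
      intro z hz
      have h0 := hpos z hz
      exact ((hσ z h0).continuousAt.div (continuousAt_id.pow 2)
        (pow_ne_zero 2 h0.ne')).continuousWithinAt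
    have hi2 : IntervalIntegrable (fun z => σ r / z ^ 2) volume r x := by
      apply ContinuousOn.intervalIntegrable
      intro z hz
      have h0 := hpos z hz
      exact (continuousAt_const.div (continuousAt_id.pow 2)
        (pow_ne_zero 2 h0.ne')).continuousWithinAt
    have hI : ∫ z in r..x, σ r / z ^ 2 = -σ r / x - -σ r / r := by
      apply intervalIntegral.integral_eq_sub_of_hasDerivAt (f := fun z => -σ r / z) _ hi2
      intro z hz
      have h0 := hpos z hz
      have := (hasDerivAt_const z (-σ r)).div (hasDerivAt_id z) h0.ne'
      have h2 : HasDerivAt (fun z => -σ r / z) ((0 * id z - -σ r * 1) / id z ^ 2) z := this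
      have h3 : (0 * id z - -σ r * 1) / id z ^ 2 = σ r / z ^ 2 := by simp
      rwa [h3] at h2
    have hle : ∫ z in r..x, σ z / z ^ 2 ≤ ∫ z in r..x, σ r / z ^ 2 := by
      rcases le_total r x with h | h
      · apply intervalIntegral.integral_mono_on h hi1 hi2
        intro z hz
        have h0 : 0 < z := lt_of_lt_of_le hr hz.1
        have := hanti hr h0 hz.1
        gcongr
      · rw [intervalIntegral.integral_symm x r, intervalIntegral.integral_symm x r]
        apply neg_le_neg
        apply intervalIntegral.integral_mono_on h hi2.symm hi1.symm
        intro z hz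
        have h0 : 0 < z := lt_of_lt_of_le hx hz.1
        have := hanti h0 hr hz.2
        gcongr
    rw [hI] at hle
    unfold xi
    calc σ r = x * (σ r / r - (-σ r / x - -σ r / r)) := by field_simp; ring
      _ ≤ _ := by gcongr
  · unfold xi
    simp
    field_simp
end

section
/- If σ'(z) < 0 for every z > 0, then for x > 0 one has ξ_r(x) = σ(r) if and only if x = r. -/
open Real MeasureTheory

theorem rolle_pos (f f' : ℝ → ℝ) (a b : ℝ) (ha : 0 < a) (hb : 0 < b)
    (hf : ∀ z > (0 : ℝ), HasDerivAt f (f' z) z) (hab : f a = f b) (hne : a ≠ b) :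
    ∃ c > (0 : ℝ), c ≠ b ∧ f' c = 0 := by
  rcases lt_or_gt_of_ne hne with h | h
  · obtain ⟨c, hc, h0⟩ := exists_hasDerivAt_eq_zero h
      (fun z hz => (hf z (lt_of_lt_of_le ha hz.1)).continuousAt.continuousWithinAt) hab
      (fun z hz => hf z (ha.trans hz.1))
    exact ⟨c, ha.trans hc.1, hc.2.ne, h0⟩
  · obtain ⟨c, hc, h0⟩ := exists_hasDerivAt_eq_zero h
      (fun z hz => (hf z (lt_of_lt_of_le hb hz.1)).continuousAt.continuousWithinAt) hab.symm
      (fun z hz => hf z (hb.trans hz.1))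
    exact ⟨c, hb.trans hc.1, hc.1.ne', h0⟩

/-- If `σ' < 0` on `(0,∞)` then for `x > 0`, `ξ_r(x) = σ(r)` iff `x = r`. -/
theorem xi_eq_sigma_r_iff (σ σ' : ℝ → ℝ) (r : ℝ) (hr : 0 < r)
    (hσ : ∀ z ∈ Set.Ioi (0 : ℝ), HasDerivAt σ (σ' z) z)
    (hσ' : ContinuousOn σ' (Set.Ioi 0))
    (hneg : ∀ z > (0 : ℝ), σ' z < 0) :
    ∀ x > (0 : ℝ), (xi σ r x = σ r ↔ x = r) := by
  intro x hx
  constructor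
  swap
  · rintro rfl
    simp only [xi, intervalIntegral.integral_same, sub_zero]
    field_simp
  intro h
  by_contra hne
  have hc : ContinuousOn (fun z => σ z / z ^ 2) (Set.Ioi 0) := by
    refine ContinuousOn.div (fun z hz => (hσ z hz).continuousAt.continuousWithinAt)
      (by fun_prop) (fun z hz => pow_ne_zero 2 (ne_of_gt hz))
  have hG : ∀ z > (0 : ℝ), HasDerivAt
      (fun y => (σ r / r - ∫ t in r..y, σ t / t ^ 2) - σ r * y⁻¹)
      ((0 - σ z / z ^ 2) - σ r * (-(z ^ 2)⁻¹)) z := by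
    intro z hz
    refine HasDerivAt.sub (HasDerivAt.sub (hasDerivAt_const _ _) ?_)
      ((hasDerivAt_inv hz.ne').const_mul _)
    refine intervalIntegral.integral_hasDerivAt_right ?_ ?_ ?_
    · refine (hc.mono fun t ht => ?_).intervalIntegrable
      exact lt_of_lt_of_le (lt_min hr hz) ht.1
    · exact hc.stronglyMeasurableAtFilter isOpen_Ioi z hz
    · exact hc.continuousAt (Ioi_mem_nhds hz)
  obtain ⟨c, hc0, hcr, h0⟩ := rolle_pos _ _ x r hx hr hG (by
    simp only [xi] at h
    simp only [intervalIntegral.integral_same]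
    rw [← div_eq_mul_inv, ← div_eq_mul_inv, sub_zero, sub_self, sub_eq_zero, eq_div_iff hx.ne',
      mul_comm, h]) hne
  have hs : σ c = σ r := by
    field_simp at h0
    linarith
  obtain ⟨d, hd, -, hd0⟩ := rolle_pos σ σ' c r hc0 hr hσ hs hcr
  exact (hneg d hd).ne hd0
end

section
/- Suppose that at every (t,x) the equations ∂_t c̃ + u₁∂₁c̃ + u₂∂₂c̃ + c̃ (div_Γ u) = γ Δ_Γ c̃ and ∂_t η = (u · ν) √(1+|∇_*η|²) hold. Then for every t the map s ↦ ∫_Q f(c̃(s,·)) √(1+|∇_*η(s,·)|²) dx is differentiable at t with derivative ∫_Q [ (f(c̃) − f'(c̃) c̃) div_Γ u − γ f''(c̃) |∇_Γ c̃|² ] √(1+|∇_*η|²) dx, where |∇_Γ c̃|² is the squared Euclidean norm in ℝ³ of the surface gradient of c̃(t,·). -/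
open Real MeasureTheory

noncomputable section

/-- The horizontal plane ℝ². -/
abbrev E2 := EuclideanSpace ℝ (Fin 2)

/-- Partial derivative ∂ᵢ of a function on ℝ². -/
noncomputable def pd (i : Fin 2) (f : E2 → ℝ) : E2 → ℝ :=
  fun x => fderiv ℝ f x (EuclideanSpace.single i 1)

/-- 1 + |∇_*η|². -/
noncomputable def nsq (η : E2 → ℝ) (x : E2) : ℝ :=
  1 + ((pd 0 η x) ^ 2 + (pd 1 η x) ^ 2)

/-- The unit normal ν = (−∂₁η, −∂₂η, 1)/√(1+|∇_*η|²). -/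
noncomputable def nu (η : E2 → ℝ) (i : Fin 3) (x : E2) : ℝ :=
  ![-(pd 0 η x), -(pd 1 η x), 1] i / Real.sqrt (nsq η x)

/-- The tangential derivative factor ν₁∂₁f + ν₂∂₂f. -/
noncomputable def tang (η f : E2 → ℝ) (x : E2) : ℝ :=
  nu η 0 x * pd 0 f x + nu η 1 x * pd 1 f x

/-- The surface derivatives ∂_{Γ,i}. -/
noncomputable def surfD (η : E2 → ℝ) (i : Fin 3) (f : E2 → ℝ) : E2 → ℝ :=
  fun x => ![pd 0 f x, pd 1 f x, (0 : ℝ)] i - nu η i x * tang η f x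

/-- Surface divergence div_Γ X = Σᵢ ∂_{Γ,i} Xᵢ. -/
noncomputable def divGamma (η : E2 → ℝ) (X : Fin 3 → E2 → ℝ) (x : E2) : ℝ :=
  ∑ i : Fin 3, surfD η i (X i) x

/-- Surface Laplacian Δ_Γ g = div_Γ (∇_Γ g). -/
noncomputable def lapGamma (η g : E2 → ℝ) (x : E2) : ℝ :=
  ∑ i : Fin 3, surfD η i (surfD η i g) x

/-- The mean curvature H = div_*(∇_*η/√(1+|∇_*η|²)). -/
noncomputable def meanH (η : E2 → ℝ) (x : E2) : ℝ :=
  pd 0 (fun y => pd 0 η y / Real.sqrt (nsq η y)) x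
    + pd 1 (fun y => pd 1 η y / Real.sqrt (nsq η y)) x

/-- Periodicity with periods L₁, L₂ in the two horizontal directions. -/
def PeriodicE2 (L₁ L₂ : ℝ) (f : E2 → ℝ) : Prop :=
  (∀ x : E2, f (x + L₁ • EuclideanSpace.single 0 1) = f x) ∧
  (∀ x : E2, f (x + L₂ • EuclideanSpace.single 1 1) = f x)

/-- The fundamental periodicity cell Q = [0,L₁] × [0,L₂]. -/
def Q2 (L₁ L₂ : ℝ) : Set E2 := {x : E2 | x 0 ∈ Set.Icc 0 L₁ ∧ x 1 ∈ Set.Icc 0 L₂}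

end

open scoped ContDiff

section helpers

lemma fderiv_dir_symm {V : Type*} [NormedAddCommGroup V] [NormedSpace ℝ V] {G : V → ℝ}
    (hG : ContDiff ℝ (⊤ : ℕ∞) G) (p v w : V) :
    fderiv ℝ (fun q => fderiv ℝ G q v) p w = fderiv ℝ (fun q => fderiv ℝ G q w) p v := by
  have hd : DifferentiableAt ℝ (fderiv ℝ G) p :=
    ((hG.fderiv_right (m := (⊤ : ℕ∞)) (by simp)).differentiable (by simp)) p
  have hs : IsSymmSndFDerivAt ℝ G p :=
    hG.contDiffAt.isSymmSndFDerivAt (by simp; exact WithTop.coe_le_coe.2 le_top)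
  have h1 : ∀ a : V, fderiv ℝ (fun q => fderiv ℝ G q a) p = (fderiv ℝ (fderiv ℝ G) p).flip a := by
    intro a
    have := fderiv_clm_apply (𝕜 := ℝ) hd (differentiableAt_const a)
    rw [this]; simp
  rw [h1, h1]
  simpa using hs w v

lemma pd_joint {g : ℝ → E2 → ℝ} (hg : ContDiff ℝ (⊤ : ℕ∞) (fun p : ℝ × E2 => g p.1 p.2))
    (i : Fin 2) (s : ℝ) (x : E2) :
    pd i (g s) x = fderiv ℝ (fun p : ℝ × E2 => g p.1 p.2) (s, x) (0, EuclideanSpace.single i 1) := by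
  have h1 : HasFDerivAt (fun p : ℝ × E2 => g p.1 p.2) _ (s, x) :=
    ((hg.differentiable (by simp)) (s, x)).hasFDerivAt
  have h2 : HasFDerivAt (fun y : E2 => (s, y)) (ContinuousLinearMap.inr ℝ ℝ E2) x :=
    hasFDerivAt_prodMk_right s x
  have h3 := (h1.comp x h2).fderiv
  have h4 : ((fun p : ℝ × E2 => g p.1 p.2) ∘ fun y : E2 => (s, y)) = g s := rfl
  rw [h4] at h3
  simp [pd, h3]

lemma hasDerivAt_joint {g : ℝ → E2 → ℝ} (hg : ContDiff ℝ (⊤ : ℕ∞) (fun p : ℝ × E2 => g p.1 p.2))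
    (s : ℝ) (x : E2) :
    HasDerivAt (fun r => g r x) (fderiv ℝ (fun p : ℝ × E2 => g p.1 p.2) (s, x) (1, 0)) s := by
  have h1 : HasFDerivAt (fun p : ℝ × E2 => g p.1 p.2) _ (s, x) :=
    ((hg.differentiable (by simp)) (s, x)).hasFDerivAt
  have h2 : HasFDerivAt (fun y : ℝ => (y, x)) (ContinuousLinearMap.inl ℝ ℝ E2) s :=
    hasFDerivAt_prodMk_left s x
  have h3 := (h1.comp s h2).hasDerivAt
  simpa [Function.comp_def] using h3

lemma contDiff_pd_joint {g : ℝ → E2 → ℝ}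
    (hg : ContDiff ℝ (⊤ : ℕ∞) (fun p : ℝ × E2 => g p.1 p.2)) (i : Fin 2) :
    ContDiff ℝ (⊤ : ℕ∞) (fun p : ℝ × E2 => pd i (g p.1) p.2) := by
  have : (fun p : ℝ × E2 => pd i (g p.1) p.2) = fun p : ℝ × E2 =>
      fderiv ℝ (fun p : ℝ × E2 => g p.1 p.2) p (0, EuclideanSpace.single i 1) := by
    funext p; exact pd_joint hg i p.1 p.2
  rw [this]
  exact (hg.fderiv_right (m := (⊤ : ℕ∞)) (by simp)).clm_apply contDiff_const

lemma contDiff_dt_joint {g : ℝ → E2 → ℝ}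
    (hg : ContDiff ℝ (⊤ : ℕ∞) (fun p : ℝ × E2 => g p.1 p.2)) :
    ContDiff ℝ (⊤ : ℕ∞) (fun p : ℝ × E2 => deriv (fun r => g r p.2) p.1) := by
  have : (fun p : ℝ × E2 => deriv (fun r => g r p.2) p.1) = fun p : ℝ × E2 =>
      fderiv ℝ (fun p : ℝ × E2 => g p.1 p.2) p (1, 0) := by
    funext p; exact (hasDerivAt_joint hg p.1 p.2).deriv
  rw [this]
  exact (hg.fderiv_right (m := (⊤ : ℕ∞)) (by simp)).clm_apply contDiff_const

lemma hasDerivAt_pd {g : ℝ → E2 → ℝ} (hg : ContDiff ℝ (⊤ : ℕ∞) (fun p : ℝ × E2 => g p.1 p.2))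
    (i : Fin 2) (s : ℝ) (x : E2) :
    HasDerivAt (fun r => pd i (g r) x) (pd i (fun y => deriv (fun r => g r y) s) x) s := by
  have h := hasDerivAt_joint (g := fun s y => pd i (g s) y) (contDiff_pd_joint hg i) s x
  convert h using 1
  rw [pd_joint (g := fun s y => deriv (fun r => g r y) s) (contDiff_dt_joint hg)]
  have e1 : (fun p : ℝ × E2 => pd i (g p.1) p.2) = fun p : ℝ × E2 =>
      fderiv ℝ (fun p : ℝ × E2 => g p.1 p.2) p (0, EuclideanSpace.single i 1) := by
    funext p; exact pd_joint hg i p.1 p.2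
  have e2 : (fun p : ℝ × E2 => deriv (fun r => g r p.2) p.1) = fun p : ℝ × E2 =>
      fderiv ℝ (fun p : ℝ × E2 => g p.1 p.2) p (1, 0) := by
    funext p; exact (hasDerivAt_joint hg p.1 p.2).deriv
  rw [e1, e2]
  exact fderiv_dir_symm hg _ _ _

lemma contDiff_slice {n : WithTop ℕ∞} {g : ℝ → E2 → ℝ}
    (hg : ContDiff ℝ n (fun p : ℝ × E2 => g p.1 p.2)) (s : ℝ) : ContDiff ℝ n (g s) :=
  hg.comp (contDiff_prodMk_right s)

lemma contDiff_pd {g : E2 → ℝ} (hg : ContDiff ℝ (⊤ : ℕ∞) g) (i : Fin 2) :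
    ContDiff ℝ (⊤ : ℕ∞) (pd i g) :=
  (hg.fderiv_right (m := (⊤ : ℕ∞)) (by simp)).clm_apply contDiff_const

lemma pd_symm {g : E2 → ℝ} (hg : ContDiff ℝ (⊤ : ℕ∞) g) (i j : Fin 2) (x : E2) :
    pd i (pd j g) x = pd j (pd i g) x := fderiv_dir_symm hg _ _ _

lemma pd_mul' {a b : E2 → ℝ} {x : E2} (i : Fin 2) (ha : DifferentiableAt ℝ a x)
    (hb : DifferentiableAt ℝ b x) :
    pd i (fun y => a y * b y) x = pd i a x * b x + a x * pd i b x := by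
  simp [pd, fderiv_fun_mul ha hb]; ring

lemma pd_add' {a b : E2 → ℝ} {x : E2} (i : Fin 2) (ha : DifferentiableAt ℝ a x)
    (hb : DifferentiableAt ℝ b x) :
    pd i (fun y => a y + b y) x = pd i a x + pd i b x := by
  simp [pd, fderiv_fun_add ha hb]

lemma pd_sub' {a b : E2 → ℝ} {x : E2} (i : Fin 2) (ha : DifferentiableAt ℝ a x)
    (hb : DifferentiableAt ℝ b x) :
    pd i (fun y => a y - b y) x = pd i a x - pd i b x := by
  simp [pd, fderiv_fun_sub ha hb]

lemma pd_comp' {h : ℝ → ℝ} {b : E2 → ℝ} {x : E2} (i : Fin 2) (ha : DifferentiableAt ℝ h (b x))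
    (hb : DifferentiableAt ℝ b x) :
    pd i (fun y => h (b y)) x = deriv h (b x) * pd i b x := by
  have := (ha.hasDerivAt.comp_hasFDerivAt x hb.hasFDerivAt).fderiv
  have e : (h ∘ b) = fun y => h (b y) := rfl
  rw [e] at this
  simp [pd, this]

lemma nsq_pos (η : E2 → ℝ) (x : E2) : 0 < nsq η x := by unfold nsq; positivity

lemma sqrt_nsq_pos (η : E2 → ℝ) (x : E2) : 0 < √(nsq η x) := Real.sqrt_pos.2 (nsq_pos η x)

lemma sq_sqrt_nsq (η : E2 → ℝ) (x : E2) :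
    √(nsq η x) ^ 2 = 1 + ((pd 0 η x) ^ 2 + (pd 1 η x) ^ 2) := by
  rw [Real.sq_sqrt (nsq_pos η x).le]; rfl

lemma pd_sqrt_nsq {η : E2 → ℝ} (hη : ContDiff ℝ (⊤ : ℕ∞) η) (i : Fin 2) (x : E2) :
    pd i (fun y => √(nsq η y)) x =
      (pd 0 η x * pd i (pd 0 η) x + pd 1 η x * pd i (pd 1 η) x) / √(nsq η x) := by
  have d : ∀ j, DifferentiableAt ℝ (pd j η) x := fun j =>
    ((contDiff_pd hη j).differentiable (by simp)) x
  have h1 : HasFDerivAt (nsq η) _ x :=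
    (((d 0).hasFDerivAt.pow 2).add ((d 1).hasFDerivAt.pow 2)).const_add 1
  have h2 := (h1.sqrt (nsq_pos η x).ne').fderiv
  simp only [pd] at *
  rw [h2]
  have := sqrt_nsq_pos η x
  simp
  field_simp

lemma hasDerivAt_sqrt_nsq {g : ℝ → E2 → ℝ}
    (hg : ContDiff ℝ (⊤ : ℕ∞) (fun p : ℝ × E2 => g p.1 p.2)) (s : ℝ) (x : E2) :
    HasDerivAt (fun r => √(nsq (g r) x))
      ((pd 0 (g s) x * pd 0 (fun y => deriv (fun r => g r y) s) x
        + pd 1 (g s) x * pd 1 (fun y => deriv (fun r => g r y) s) x) / √(nsq (g s) x)) s := by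
  have h1 : HasDerivAt (fun r => nsq (g r) x) _ s :=
    (((hasDerivAt_pd hg 0 s x).pow 2).add ((hasDerivAt_pd hg 1 s x).pow 2)).const_add 1
  have h2 := h1.sqrt (nsq_pos (g s) x).ne'
  convert h2 using 1
  have := sqrt_nsq_pos (g s) x
  simp
  field_simp

lemma contDiff_sqrt_nsq_joint {g : ℝ → E2 → ℝ}
    (hg : ContDiff ℝ (⊤ : ℕ∞) (fun p : ℝ × E2 => g p.1 p.2)) :
    ContDiff ℝ (⊤ : ℕ∞) (fun p : ℝ × E2 => √(nsq (g p.1) p.2)) := by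
  have h : ContDiff ℝ (⊤ : ℕ∞) (fun p : ℝ × E2 => nsq (g p.1) p.2) :=
    contDiff_const.add (((contDiff_pd_joint hg 0).pow 2).add ((contDiff_pd_joint hg 1).pow 2))
  exact h.sqrt fun p => (nsq_pos _ _).ne'

lemma contDiff_sqrt_nsq {η : E2 → ℝ} (hη : ContDiff ℝ (⊤ : ℕ∞) η) :
    ContDiff ℝ (⊤ : ℕ∞) (fun y => √(nsq η y)) := by
  have h : ContDiff ℝ (⊤ : ℕ∞) (nsq η) :=
    contDiff_const.add (((contDiff_pd hη 0).pow 2).add ((contDiff_pd hη 1).pow 2))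
  exact h.sqrt fun p => (nsq_pos _ _).ne'

lemma contDiff_nu {η : E2 → ℝ} (hη : ContDiff ℝ (⊤ : ℕ∞) η) (i : Fin 3) :
    ContDiff ℝ (⊤ : ℕ∞) (nu η i) := by
  refine ContDiff.div ?_ (contDiff_sqrt_nsq hη) fun x => (sqrt_nsq_pos η x).ne'
  have h0 := contDiff_pd hη 0
  have h1 := contDiff_pd hη 1
  fin_cases i
  · simpa using h0.neg
  · simpa using h1.neg
  · simpa using contDiff_const

lemma contDiff_surfD {η g : E2 → ℝ} (hη : ContDiff ℝ (⊤ : ℕ∞) η) (hg : ContDiff ℝ (⊤ : ℕ∞) g)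
    (i : Fin 3) : ContDiff ℝ (⊤ : ℕ∞) (surfD η i g) := by
  have h0 := contDiff_pd hg 0
  have h1 := contDiff_pd hg 1
  refine ContDiff.sub ?_ ((contDiff_nu hη i).mul
    (((contDiff_nu hη 0).mul h0).add ((contDiff_nu hη 1).mul h1)))
  fin_cases i
  · simpa using h0
  · simpa using h1
  · simpa using contDiff_const

lemma divGamma_mul_sqrt (η : E2 → ℝ) (X : Fin 3 → E2 → ℝ) (x : E2) :
    divGamma η X x * √(nsq η x) =
      √(nsq η x) * (pd 0 (X 0) x + pd 1 (X 1) x)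
      + (pd 0 η x * pd 0 (X 2) x + pd 1 η x * pd 1 (X 2) x
        - (pd 0 η x * pd 0 η x * pd 0 (X 0) x + pd 0 η x * pd 1 η x * pd 1 (X 0) x
          + pd 1 η x * pd 0 η x * pd 0 (X 1) x + pd 1 η x * pd 1 η x * pd 1 (X 1) x))
          / √(nsq η x) := by
  have := sqrt_nsq_pos η x
  simp [divGamma, surfD, tang, nu, Fin.sum_univ_three]
  field_simp
  ring

lemma surfD_two (η g : E2 → ℝ) (x : E2) :
    surfD η 2 g x = surfD η 0 g x * pd 0 η x + surfD η 1 g x * pd 1 η x := by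
  have := sqrt_nsq_pos η x
  have h2 := sq_sqrt_nsq η x
  simp [surfD, tang, nu]
  field_simp
  rw [h2]; ring

lemma sum_sq_surfD (η g : E2 → ℝ) (x : E2) :
    ∑ i : Fin 3, (surfD η i g x) ^ 2 = surfD η 0 g x * pd 0 g x + surfD η 1 g x * pd 1 g x := by
  have := sqrt_nsq_pos η x
  have h2 := sq_sqrt_nsq η x
  simp [surfD, tang, nu, Fin.sum_univ_three]
  field_simp
  have h4 : pd 0 η x ^ 2 = √(nsq η x) ^ 2 - 1 - pd 1 η x ^ 2 := by linarith
  ring_nf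
  grind

lemma lapGamma_mul_sqrt {η g : E2 → ℝ} (hη : ContDiff ℝ (⊤ : ℕ∞) η) (hg : ContDiff ℝ (⊤ : ℕ∞) g)
    (x : E2) :
    lapGamma η g x * √(nsq η x) =
      √(nsq η x) * (pd 0 (surfD η 0 g) x + pd 1 (surfD η 1 g) x)
       + (surfD η 0 g x * pd 0 (fun y => √(nsq η y)) x
        + surfD η 1 g x * pd 1 (fun y => √(nsq η y)) x) := by
  have e : lapGamma η g x = divGamma η (fun i => surfD η i g) x := rfl
  have dX : ∀ i, DifferentiableAt ℝ (surfD η i g) x := fun i =>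
    ((contDiff_surfD hη hg i).differentiable (by simp)) x
  have dη : ∀ j, DifferentiableAt ℝ (pd j η) x := fun j =>
    ((contDiff_pd hη j).differentiable (by simp)) x
  have h2 : surfD η 2 g = fun y => surfD η 0 g y * pd 0 η y + surfD η 1 g y * pd 1 η y :=
    funext (surfD_two η g)
  have h3 : ∀ i, pd i (surfD η 2 g) x = pd i (surfD η 0 g) x * pd 0 η x
      + surfD η 0 g x * pd i (pd 0 η) x + (pd i (surfD η 1 g) x * pd 1 η x
      + surfD η 1 g x * pd i (pd 1 η) x) := by
    intro i
    rw [h2, pd_add' i ((dX 0).fun_mul (dη 0)) ((dX 1).fun_mul (dη 1)), pd_mul' i (dX 0) (dη 0),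
      pd_mul' i (dX 1) (dη 1)]
  rw [e, divGamma_mul_sqrt, h3, h3, pd_sqrt_nsq hη, pd_sqrt_nsq hη, pd_symm hη 1 0]
  ring


noncomputable def embE2 : ℝ × ℝ →L[ℝ] E2 :=
  (ContinuousLinearMap.fst ℝ ℝ ℝ).smulRight (EuclideanSpace.single 0 1 : E2)
    + (ContinuousLinearMap.snd ℝ ℝ ℝ).smulRight (EuclideanSpace.single 1 1 : E2)

lemma embE2_apply (q : ℝ × ℝ) : embE2 q =
    q.1 • (EuclideanSpace.single 0 1 : E2) + q.2 • (EuclideanSpace.single 1 1 : E2) := by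
  simp [embE2]

lemma embE2_eq : (embE2 : ℝ × ℝ → E2) =
    ((MeasurableEquiv.finTwoArrow (α := ℝ)).symm.trans (MeasurableEquiv.toLp 2 (Fin 2 → ℝ))) := by
  funext q
  ext i
  rw [embE2_apply]
  fin_cases i <;> simp [MeasurableEquiv.finTwoArrow]

lemma embE2_preserving : MeasurePreserving (embE2 : ℝ × ℝ → E2) volume volume := by
  rw [embE2_eq]
  exact (PiLp.volume_preserving_toLp (Fin 2)).comp ((volume_preserving_finTwoArrow ℝ).symm _)

lemma embE2_emb : MeasurableEmbedding (embE2 : ℝ × ℝ → E2) := by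
  rw [embE2_eq]
  exact MeasurableEquiv.measurableEmbedding _

lemma embE2_preimage (L₁ L₂ : ℝ) : embE2 ⁻¹' (Q2 L₁ L₂) = Set.Icc (0, 0) (L₁, L₂) := by
  ext q
  simp [Q2, embE2_apply, Prod.le_def]
  tauto

lemma isCompact_Q2 (L₁ L₂ : ℝ) : IsCompact (Q2 L₁ L₂) := by
  have h : Q2 L₁ L₂ = embE2 '' (Set.Icc (0, 0) (L₁, L₂)) := by
    rw [← embE2_preimage, Set.image_preimage_eq]
    rw [embE2_eq]
    exact MeasurableEquiv.surjective _
  rw [h]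
  exact isCompact_Icc.image embE2.continuous

lemma integral_Q2_div {L₁ L₂ : ℝ} (hL₁ : 0 < L₁) (hL₂ : 0 < L₂) {P R : E2 → ℝ}
    (hP : ContDiff ℝ 1 P) (hR : ContDiff ℝ 1 R)
    (pP : PeriodicE2 L₁ L₂ P) (pR : PeriodicE2 L₁ L₂ R) :
    ∫ x in Q2 L₁ L₂, (pd 0 P x + pd 1 R x) = 0 := by
  rw [← embE2_preserving.setIntegral_preimage_emb embE2_emb, embE2_preimage]
  have key := integral_divergence_prod_Icc_of_hasFDerivAt_of_le
    (fun q => P (embE2 q)) (fun q => R (embE2 q))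
    (fun q => (fderiv ℝ P (embE2 q)).comp embE2) (fun q => (fderiv ℝ R (embE2 q)).comp embE2)
    (0, 0) (L₁, L₂) ⟨hL₁.le, hL₂.le⟩
    (hP.continuous.comp embE2.continuous).continuousOn
    (hR.continuous.comp embE2.continuous).continuousOn
    (fun q _ => ((hP.differentiable (by simp)) _).hasFDerivAt.comp q embE2.hasFDerivAt)
    (fun q _ => ((hR.differentiable (by simp)) _).hasFDerivAt.comp q embE2.hasFDerivAt)
    (by
      refine ContinuousOn.integrableOn_compact isCompact_Icc (Continuous.continuousOn ?_)
      have h1 := (hP.continuous_fderiv (by simp)).comp embE2.continuous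
      have h2 := (hR.continuous_fderiv (by simp)).comp embE2.continuous
      simp only [ContinuousLinearMap.comp_apply]
      exact (h1.clm_apply continuous_const).add (h2.clm_apply continuous_const))
  have e0 : embE2 (1, 0) = EuclideanSpace.single 0 1 := by simp [embE2_apply]
  have e1 : embE2 (0, 1) = EuclideanSpace.single 1 1 := by simp [embE2_apply]
  simp only [ContinuousLinearMap.comp_apply, e0, e1] at key
  have h1 : ∀ y, P (embE2 (L₁, y)) = P (embE2 (0, y)) := by
    intro y
    rw [← pP.1 (embE2 (0, y))]
    congr 1; simp only [embE2_apply]; module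
  have h2 : ∀ y, R (embE2 (y, L₂)) = R (embE2 (y, 0)) := by
    intro y
    rw [← pR.2 (embE2 (y, 0))]
    congr 1; simp only [embE2_apply]; module
  simp only [h1, h2] at key
  unfold pd
  rw [key]; ring

lemma hasDerivAt_integral_Q2 (L₁ L₂ : ℝ) {F F' : ℝ → E2 → ℝ}
    (hF : Continuous (fun p : ℝ × E2 => F p.1 p.2))
    (hF' : Continuous (fun p : ℝ × E2 => F' p.1 p.2))
    (hd : ∀ s x, HasDerivAt (fun r => F r x) (F' s x) s) (t : ℝ) :
    HasDerivAt (fun s => ∫ x in Q2 L₁ L₂, F s x) (∫ x in Q2 L₁ L₂, F' t x) t := by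
  have hQ := isCompact_Q2 L₁ L₂
  obtain ⟨C, hC⟩ := ((isCompact_Icc (a := t - 1) (b := t + 1)).prod hQ).exists_bound_of_continuousOn
    hF'.continuousOn
  have sl : ∀ s, Continuous (F s) := fun s => hF.comp (Continuous.prodMk_right s)
  have sl' : ∀ s, Continuous (F' s) := fun s => hF'.comp (Continuous.prodMk_right s)
  refine (hasDerivAt_integral_of_dominated_loc_of_deriv_le (F' := F') (bound := fun _ => C)
    (s := Set.Icc (t - 1) (t + 1)) (Icc_mem_nhds (by linarith) (by linarith))
    (Filter.Eventually.of_forall fun s => (sl s).aestronglyMeasurable)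
    ((sl t).continuousOn.integrableOn_compact hQ) (sl' t).aestronglyMeasurable ?_ ?_ ?_).2
  · refine (ae_restrict_iff' hQ.measurableSet).2 (Filter.Eventually.of_forall fun x hx s hs => ?_)
    exact hC (s, x) ⟨hs, hx⟩
  · exact integrableOn_const hQ.measure_lt_top.ne
  · exact Filter.Eventually.of_forall fun x s _ => hd s x

lemma periodic_pd {L₁ L₂ : ℝ} {g : E2 → ℝ} (hg : PeriodicE2 L₁ L₂ g) (i : Fin 2) :
    PeriodicE2 L₁ L₂ (pd i g) := by
  constructor
  · intro x
    have : (fun y => g (y + L₁ • EuclideanSpace.single 0 1)) = g := funext hg.1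
    unfold pd
    rw [← fderiv_comp_add_right, this]
  · intro x
    have : (fun y => g (y + L₂ • EuclideanSpace.single 1 1)) = g := funext hg.2
    unfold pd
    rw [← fderiv_comp_add_right, this]


/-- Horizontal flux whose divergence relates the two integrands. -/
noncomputable def fluxP (γ : ℝ) (f : ℝ → ℝ) (η c : E2 → ℝ) (w : E2 → ℝ) (j : Fin 3) (x : E2) : ℝ :=
  (γ * deriv f (c x)) * (√(nsq η x) * surfD η j c x) - f (c x) * (w x * √(nsq η x))

lemma contDiff_deriv_f {f : ℝ → ℝ} (hf : ContDiff ℝ 2 f) : ContDiff ℝ 1 (deriv f) := by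
  have : ContDiff ℝ (1 + 1) f := by simpa [one_add_one_eq_two] using hf
  exact (contDiff_succ_iff_deriv.1 this).2.2

lemma contDiff_fluxP (γ : ℝ) {f : ℝ → ℝ} (hf : ContDiff ℝ 2 f) {η c w : E2 → ℝ}
    (hη : ContDiff ℝ (⊤ : ℕ∞) η) (hc : ContDiff ℝ (⊤ : ℕ∞) c) (hw : ContDiff ℝ (⊤ : ℕ∞) w)
    (j : Fin 3) : ContDiff ℝ 1 (fluxP γ f η c w j) := by
  have l : (1 : WithTop ℕ∞) ≤ ((⊤ : ℕ∞) : WithTop ℕ∞) := WithTop.coe_le_coe.2 le_top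
  have c1 := hc.of_le l
  have S1 := (contDiff_sqrt_nsq hη).of_le l
  have X1 := (contDiff_surfD hη hc j).of_le l
  have w1 := hw.of_le l
  exact ((contDiff_const.mul ((contDiff_deriv_f hf).comp c1)).mul (S1.mul X1)).sub
    (((hf.of_le (by norm_num)).comp c1).mul (w1.mul S1))

lemma pd_fluxP (γ : ℝ) {f : ℝ → ℝ} (hf : ContDiff ℝ 2 f) {η c w : E2 → ℝ}
    (hη : ContDiff ℝ (⊤ : ℕ∞) η) (hc : ContDiff ℝ (⊤ : ℕ∞) c) (hw : ContDiff ℝ (⊤ : ℕ∞) w)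
    (j : Fin 3) (i : Fin 2) (x : E2) :
    pd i (fluxP γ f η c w j) x =
      γ * (deriv (deriv f) (c x) * pd i c x) * (√(nsq η x) * surfD η j c x)
      + γ * deriv f (c x) * (pd i (fun y => √(nsq η y)) x * surfD η j c x
        + √(nsq η x) * pd i (surfD η j c) x)
      - (deriv f (c x) * pd i c x * (w x * √(nsq η x))
        + f (c x) * (pd i w x * √(nsq η x) + w x * pd i (fun y => √(nsq η y)) x)) := by
  have dc : DifferentiableAt ℝ c x := (hc.differentiable (by simp)) x
  have dw : DifferentiableAt ℝ w x := (hw.differentiable (by simp)) x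
  have dS : DifferentiableAt ℝ (fun y => √(nsq η y)) x :=
    ((contDiff_sqrt_nsq hη).differentiable (by simp)) x
  have dX : DifferentiableAt ℝ (surfD η j c) x :=
    ((contDiff_surfD hη hc j).differentiable (by simp)) x
  have df : DifferentiableAt ℝ f (c x) := (hf.differentiable (by simp)) _
  have df' : DifferentiableAt ℝ (deriv f) (c x) :=
    ((contDiff_deriv_f hf).differentiable (by simp)) _
  have dfc : DifferentiableAt ℝ (fun y => f (c y)) x := df.comp x dc
  have dfc' : DifferentiableAt ℝ (fun y => deriv f (c y)) x := df'.comp x dc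
  have dg : DifferentiableAt ℝ (fun y => γ * deriv f (c y)) x := dfc'.const_mul γ
  have hg : pd i (fun y => γ * deriv f (c y)) x = γ * (deriv (deriv f) (c x) * pd i c x) := by
    rw [pd_mul' (a := fun _ => γ) i (differentiableAt_const γ) dfc', pd_comp' i df' dc]
    simp [pd]
  unfold fluxP
  rw [pd_sub' i (dg.fun_mul (dS.fun_mul dX)) (dfc.fun_mul (dw.fun_mul dS)),
    pd_mul' i dg (dS.fun_mul dX), pd_mul' i dS dX, pd_mul' i dfc (dw.fun_mul dS),
    pd_mul' i dw dS, hg, pd_comp' i df dc]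

lemma periodic_fluxP {L₁ L₂ : ℝ} (γ : ℝ) (f : ℝ → ℝ) {η c w : E2 → ℝ}
    (hη : PeriodicE2 L₁ L₂ η) (hc : PeriodicE2 L₁ L₂ c) (hw : PeriodicE2 L₁ L₂ w) (j : Fin 3) :
    PeriodicE2 L₁ L₂ (fluxP γ f η c w j) := by
  have a0 := periodic_pd hη 0
  have a1 := periodic_pd hη 1
  have b0 := periodic_pd hc 0
  have b1 := periodic_pd hc 1
  constructor <;> intro x
  · simp only [fluxP, surfD, tang, nu, nsq, a0.1 x, a1.1 x, b0.1 x, b1.1 x, hc.1 x, hw.1 x]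
  · simp only [fluxP, surfD, tang, nu, nsq, a0.2 x, a1.2 x, b0.2 x, b1.2 x, hc.2 x, hw.2 x]

/-- The pointwise identity, for a fixed time; `ct`, `ηt` are the time derivatives. -/
lemma pointwise_identity (γ : ℝ) {f : ℝ → ℝ} (hf : ContDiff ℝ 2 f) {η c ηt : E2 → ℝ}
    {w : Fin 3 → E2 → ℝ} (ct : ℝ)
    (hη : ContDiff ℝ (⊤ : ℕ∞) η) (hc : ContDiff ℝ (⊤ : ℕ∞) c)
    (hw : ∀ i, ContDiff ℝ (⊤ : ℕ∞) (w i)) (x : E2)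
    (heqc : ct + w 0 x * pd 0 c x + w 1 x * pd 1 c x + c x * divGamma η w x
        = γ * lapGamma η c x)
    (heqη : ∀ y, ηt y = (∑ i : Fin 3, w i y * nu η i y) * √(nsq η y)) :
    deriv f (c x) * ct * √(nsq η x)
      + f (c x) * ((pd 0 η x * pd 0 ηt x + pd 1 η x * pd 1 ηt x) / √(nsq η x))
    = ((f (c x) - deriv f (c x) * c x) * divGamma η w x
        - γ * deriv (deriv f) (c x) * ∑ i : Fin 3, (surfD η i c x) ^ 2) * √(nsq η x)
      + (pd 0 (fluxP γ f η c (w 0) 0) x + pd 1 (fluxP γ f η c (w 1) 1) x) := by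
  have e : ηt = fun y => w 2 y - (w 0 y * pd 0 η y + w 1 y * pd 1 η y) := by
    funext y
    have := sqrt_nsq_pos η y
    rw [heqη]
    simp [nu, Fin.sum_univ_three]
    field_simp
    ring
  have dw : ∀ i, DifferentiableAt ℝ (w i) x := fun i => ((hw i).differentiable (by simp)) x
  have dη : ∀ j, DifferentiableAt ℝ (pd j η) x := fun j =>
    ((contDiff_pd hη j).differentiable (by simp)) x
  have pe : ∀ i, pd i ηt x = pd i (w 2) x - ((pd i (w 0) x * pd 0 η x + w 0 x * pd i (pd 0 η) x)
      + (pd i (w 1) x * pd 1 η x + w 1 x * pd i (pd 1 η) x)) := by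
    intro i
    rw [e, pd_sub' i (dw 2) (((dw 0).fun_mul (dη 0)).fun_add ((dw 1).fun_mul (dη 1))),
      pd_add' i ((dw 0).fun_mul (dη 0)) ((dw 1).fun_mul (dη 1)), pd_mul' i (dw 0) (dη 0),
      pd_mul' i (dw 1) (dη 1)]
  have hct : ct = γ * lapGamma η c x - w 0 x * pd 0 c x - w 1 x * pd 1 c x
      - c x * divGamma η w x := by linarith
  have hlap := lapGamma_mul_sqrt hη hc x
  have hdiv := divGamma_mul_sqrt η w x
  -- the evolution of the area element
  have hS : (pd 0 η x * pd 0 ηt x + pd 1 η x * pd 1 ηt x) / √(nsq η x)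
      = divGamma η w x * √(nsq η x) - √(nsq η x) * (pd 0 (w 0) x + pd 1 (w 1) x)
        - (w 0 x * pd 0 (fun y => √(nsq η y)) x + w 1 x * pd 1 (fun y => √(nsq η y)) x) := by
    rw [hdiv, pe, pe, pd_sqrt_nsq hη, pd_sqrt_nsq hη, pd_symm hη 1 0]
    ring
  rw [hS, hct, sum_sq_surfD, pd_fluxP γ hf hη hc (hw 0), pd_fluxP γ hf hη hc (hw 1)]
  linear_combination (γ * deriv f (c x)) * hlap

end helpers

/-- Evolution of ∫_Q f(c̃)√(1+|∇_*η|²) for solutions of the surfactant transport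
equation coupled to the kinematic boundary condition. -/
theorem surfactant_renormalized_evolution
    (L₁ L₂ : ℝ) (hL₁ : 0 < L₁) (hL₂ : 0 < L₂) (γ : ℝ) (hγ : 0 < γ)
    (f : ℝ → ℝ) (hf : ContDiff ℝ 2 f)
    (η c : ℝ → E2 → ℝ) (u : ℝ → E2 → Fin 3 → ℝ)
    (hη : ContDiff ℝ (⊤ : ℕ∞) (fun p : ℝ × E2 => η p.1 p.2))
    (hc : ContDiff ℝ (⊤ : ℕ∞) (fun p : ℝ × E2 => c p.1 p.2))
    (hu : ContDiff ℝ (⊤ : ℕ∞) (fun p : ℝ × E2 => u p.1 p.2))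
    (hηp : ∀ t, PeriodicE2 L₁ L₂ (η t))
    (hcp : ∀ t, PeriodicE2 L₁ L₂ (c t))
    (hup : ∀ t i, PeriodicE2 L₁ L₂ (fun x => u t x i))
    (heqc : ∀ t x, deriv (fun s => c s x) t
        + u t x 0 * pd 0 (c t) x + u t x 1 * pd 1 (c t) x
        + c t x * divGamma (η t) (fun i y => u t y i) x
        = γ * lapGamma (η t) (c t) x)
    (heqη : ∀ t x, deriv (fun s => η s x) t
        = (∑ i : Fin 3, u t x i * nu (η t) i x) * Real.sqrt (nsq (η t) x)) :
    ∀ t, HasDerivAt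
      (fun s => ∫ x in Q2 L₁ L₂, f (c s x) * Real.sqrt (nsq (η s) x))
      (∫ x in Q2 L₁ L₂,
        ((f (c t x) - deriv f (c t x) * c t x) * divGamma (η t) (fun i y => u t y i) x
          - γ * deriv (deriv f) (c t x) * ∑ i : Fin 3, (surfD (η t) i (c t) x) ^ 2)
          * Real.sqrt (nsq (η t) x)) t := by
  intro t
  have hw : ∀ i, ContDiff ℝ (⊤ : ℕ∞) (fun p : ℝ × E2 => u p.1 p.2 i) := fun i =>
    contDiff_pi.1 hu i
  have hηs := contDiff_slice hη
  have hcs := contDiff_slice hc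
  have hws : ∀ s i, ContDiff ℝ (⊤ : ℕ∞) (fun y => u s y i) := fun s i =>
    contDiff_slice (g := fun s y => u s y i) (hw i) s
  have hdtη := contDiff_dt_joint hη
  have hcf : Continuous (fun p : ℝ × E2 => f (c p.1 p.2)) := hf.continuous.comp hc.continuous
  have hcf' : Continuous (fun p : ℝ × E2 => deriv f (c p.1 p.2)) :=
    (contDiff_deriv_f hf).continuous.comp hc.continuous
  have hS := (contDiff_sqrt_nsq_joint hη).continuous
  have hF'c : Continuous (fun p : ℝ × E2 =>
      deriv f (c p.1 p.2) * deriv (fun r => c r p.2) p.1 * √(nsq (η p.1) p.2)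
      + f (c p.1 p.2) * ((pd 0 (η p.1) p.2 * pd 0 (fun y => deriv (fun r => η r y) p.1) p.2
        + pd 1 (η p.1) p.2 * pd 1 (fun y => deriv (fun r => η r y) p.1) p.2)
          / √(nsq (η p.1) p.2))) := by
    have q0 := (contDiff_pd_joint hη 0).continuous
    have q1 := (contDiff_pd_joint hη 1).continuous
    have r0 := (contDiff_pd_joint (g := fun s y => deriv (fun r => η r y) s) hdtη 0).continuous
    have r1 := (contDiff_pd_joint (g := fun s y => deriv (fun r => η r y) s) hdtη 1).continuous
    exact ((hcf'.mul (contDiff_dt_joint hc).continuous).mul hS).add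
      (hcf.mul (((q0.mul r0).add (q1.mul r1)).div hS fun p => (sqrt_nsq_pos _ _).ne'))
  have main := hasDerivAt_integral_Q2 L₁ L₂
    (F := fun s x => f (c s x) * √(nsq (η s) x))
    (F' := fun s x => deriv f (c s x) * deriv (fun r => c r x) s * √(nsq (η s) x)
      + f (c s x) * ((pd 0 (η s) x * pd 0 (fun y => deriv (fun r => η r y) s) x
        + pd 1 (η s) x * pd 1 (fun y => deriv (fun r => η r y) s) x) / √(nsq (η s) x)))
    (hcf.mul hS) hF'c
    (fun s x => by
      have h1 : HasDerivAt (fun r => c r x) (deriv (fun r => c r x) s) s :=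
        (hasDerivAt_joint hc s x).differentiableAt.hasDerivAt
      have h2 : HasDerivAt (fun r => f (c r x)) (deriv f (c s x) * deriv (fun r => c r x) s) s :=
        ((hf.differentiable (by simp)) (c s x)).hasDerivAt.comp s h1
      exact h2.mul (hasDerivAt_sqrt_nsq hη s x)) t
  convert main using 1
  have cP := contDiff_fluxP γ hf (hηs t) (hcs t) (hws t 0) 0
  have cR := contDiff_fluxP γ hf (hηs t) (hcs t) (hws t 1) 1
  have hdiv := integral_Q2_div hL₁ hL₂ cP cR
    (periodic_fluxP γ f (hηp t) (hcp t) (hup t 0) 0)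
    (periodic_fluxP γ f (hηp t) (hcp t) (hup t 1) 1)
  have cd : Continuous (fun x => pd 0 (fluxP γ f (η t) (c t) (fun y => u t y 0) 0) x
      + pd 1 (fluxP γ f (η t) (c t) (fun y => u t y 1) 1) x) :=
    ((cP.continuous_fderiv (by simp)).clm_apply continuous_const).add
      ((cR.continuous_fderiv (by simp)).clm_apply continuous_const)
  have hQ := isCompact_Q2 L₁ L₂
  rw [← sub_zero (∫ x in Q2 L₁ L₂, _ + _), ← hdiv]
  refine Eq.trans ?_ (integral_sub (μ := volume.restrict (Q2 L₁ L₂))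
    ((hF'c.comp (Continuous.prodMk_right t)).continuousOn.integrableOn_compact hQ)
    (cd.continuousOn.integrableOn_compact hQ))
  refine integral_congr_ae (Filter.Eventually.of_forall fun x => ?_)
  have h := pointwise_identity γ hf (deriv (fun r => c r x) t) (hηs t) (hcs t)
    (w := fun i y => u t y i) (ηt := fun y => deriv (fun r => η r y) t)
    (hws t) x (heqc t x) (heqη t)
  exact eq_sub_of_add_eq h.symm
end
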